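/- arXiv:2107.02671 — 2 statements merged into one kernel-verified Lean document; each statement's English description precedes it below -/
import Mathlib

section
/- Let m ∈ ℕ with m ≥ 2 and σ ∈ [5/4, 2]. Then the Fourier transform ω̂_sinh(v) := ∫_ℝ ω_sinh(x) e^{−2πivx} dx = 2∫_0^1 ω_sinh(x) cos(2πvx) dx of the sinh-type function is positive and decreasing for v ∈ [0, m/(2σ)]; consequently ω_sinh belongs to the set Ω. -/
open scoped Real
open MeasureTheory Filter Finset

noncomputable section

/-- Fourier transform of an even real-valued window function (real cosine form):
for even real `φ` one has `φ̂(v) = ∫_ℝ φ(x) e^{-2πivx} dx = ∫_ℝ φ(x) cos(2πvx) dx`. -/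
def ftR (φ : ℝ → ℝ) (v : ℝ) : ℝ := ∫ x : ℝ, φ x * Real.cos (2 * Real.pi * v * x)

/-- Index set `I_M = {−M/2, …, M/2−1}`. -/
def Iset (M : ℕ) : Finset ℤ := Finset.Icc (-(M : ℤ) / 2) ((M : ℤ) / 2 - 1)

/-- `ω` belongs to the set `Ω` (with parameters `m`, `σ`): even, continuous, supported on
`[-1,1]`, with values in `[0,1]`, decreasing on `[0,1]`, `ω(0)=1`, and Fourier transform
positive and decreasing on `[0, m/(2σ)]`. -/
def InOmega (m : ℕ) (σ : ℝ) (ω : ℝ → ℝ) : Prop :=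
  (∀ x, ω x ∈ Set.Icc (0 : ℝ) 1) ∧ (∀ x, ω (-x) = ω x) ∧ Continuous ω ∧
    (∀ x, 1 < |x| → ω x = 0) ∧ AntitoneOn ω (Set.Icc 0 1) ∧ ω 0 = 1 ∧
    (∀ v ∈ Set.Icc (0 : ℝ) ((m : ℝ) / (2 * σ)), 0 < ftR ω v) ∧
    AntitoneOn (ftR ω) (Set.Icc (0 : ℝ) ((m : ℝ) / (2 * σ)))

/-- The sinh-type function with parameters `m`, `σ` and shape parameter `β = 2πm(1 − 1/(2σ))`. -/
def omegaSinh (m : ℕ) (σ : ℝ) (x : ℝ) : ℝ :=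
  if |x| ≤ 1 then
    Real.sinh (2 * Real.pi * m * (1 - 1 / (2 * σ)) * Real.sqrt (1 - x ^ 2)) /
      Real.sinh (2 * Real.pi * m * (1 - 1 / (2 * σ)))
  else 0

lemma re_sinh_laurent_circleMap (a b θ : ℝ) {R : ℝ} (hR : R ≠ 0) :
    (Complex.sinh (a * circleMap 0 R θ + b * (circleMap 0 R θ)⁻¹) *
      (circleMap 0 R θ + (circleMap 0 R θ)⁻¹)).re =
    (R + R⁻¹) * (Real.cos θ * (Real.sinh ((a * R + b * R⁻¹) * Real.cos θ) *
        Real.cos ((a * R - b * R⁻¹) * Real.sin θ))) -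
      (R - R⁻¹) * (Real.sin θ * (Real.cosh ((a * R + b * R⁻¹) * Real.cos θ) *
        Real.sin ((a * R - b * R⁻¹) * Real.sin θ))) := by
  have hz : circleMap 0 R θ = ((R * Real.cos θ : ℝ) : ℂ) + ((R * Real.sin θ : ℝ) : ℂ) * Complex.I := by
    rw [circleMap_zero, Complex.exp_mul_I]
    push_cast
    ring
  have hz' : (circleMap 0 R θ)⁻¹ =
      ((R⁻¹ * Real.cos θ : ℝ) : ℂ) - ((R⁻¹ * Real.sin θ : ℝ) : ℂ) * Complex.I := by
    have hne : (R : ℂ) ≠ 0 := by exact_mod_cast hR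
    have hsc : Complex.sin θ ^ 2 + Complex.cos θ ^ 2 = 1 := Complex.sin_sq_add_cos_sq _
    refine inv_eq_of_mul_eq_one_right ?_
    rw [hz]
    push_cast
    field_simp
    linear_combination hsc - Complex.sin θ ^ 2 * Complex.I_sq
  have harg : (a : ℂ) * circleMap 0 R θ + b * (circleMap 0 R θ)⁻¹ =
      (((a * R + b * R⁻¹) * Real.cos θ : ℝ) : ℂ) +
        (((a * R - b * R⁻¹) * Real.sin θ : ℝ) : ℂ) * Complex.I := by
    rw [hz', hz]
    push_cast
    ring
  have hsum : circleMap 0 R θ + (circleMap 0 R θ)⁻¹ =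
      (((R + R⁻¹) * Real.cos θ : ℝ) : ℂ) + (((R - R⁻¹) * Real.sin θ : ℝ) : ℂ) * Complex.I := by
    rw [hz', hz]
    push_cast
    ring
  rw [harg, hsum, Complex.sinh_add, Complex.sinh_mul_I, Complex.cosh_mul_I]
  simp only [← Complex.ofReal_sinh, ← Complex.ofReal_cosh, ← Complex.ofReal_sin,
    ← Complex.ofReal_cos, Complex.mul_re, Complex.add_re, Complex.add_im, Complex.mul_im,
    Complex.ofReal_re, Complex.ofReal_im, Complex.I_re, Complex.I_im]
  ring

lemma integral_sinh_laurent_circleMap_eq (a b : ℝ) {r : ℝ} (hr : 0 < r) (hr1 : r ≤ 1) :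
    (∫ θ in (0 : ℝ)..2 * π, (Complex.sinh (a * circleMap 0 1 θ + b * (circleMap 0 1 θ)⁻¹) *
      (circleMap 0 1 θ + (circleMap 0 1 θ)⁻¹)).re) =
    ∫ θ in (0 : ℝ)..2 * π, (Complex.sinh (a * circleMap 0 r θ + b * (circleMap 0 r θ)⁻¹) *
      (circleMap 0 r θ + (circleMap 0 r θ)⁻¹)).re := by
  set f : ℂ → ℂ := fun z => Complex.sinh (a * z + b * z⁻¹) * (z + z⁻¹) with hf
  have hd : ∀ z : ℂ, z ≠ 0 → DifferentiableAt ℂ f z := by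
    intro z hz
    have hinv : DifferentiableAt ℂ (fun z : ℂ => z⁻¹) z := differentiableAt_inv hz
    exact (((differentiableAt_id.const_mul _).add (hinv.const_mul _)).csinh).mul
      (differentiableAt_id.add hinv)
  have hcirc := Complex.circleIntegral_sub_center_inv_smul_eq_of_differentiable_on_annulus_off_countable
    (c := 0) hr hr1 (f := f) Set.countable_empty
    (fun z hz => (hd z (by
      rintro rfl
      exact hz.2 (Metric.mem_ball_self hr))).continuousAt.continuousWithinAt)
    (fun z hz => hd z (by
      rintro rfl
      exact hz.1.2 (Metric.mem_closedBall_self hr.le)))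
  have hparam : ∀ R : ℝ, 0 < R → (∮ z in C(0, R), (z - 0)⁻¹ • f z) =
      Complex.I * ∫ θ in (0 : ℝ)..2 * π, f (circleMap 0 R θ) := by
    intro R hR
    rw [circleIntegral, ← intervalIntegral.integral_const_mul]
    refine intervalIntegral.integral_congr fun θ _ => ?_
    have hne : circleMap 0 R θ ≠ 0 := circleMap_ne_center hR.ne'
    simp only [deriv_circleMap, smul_eq_mul, sub_zero]
    field_simp
  have hre : ∀ R : ℝ, 0 < R → (∫ θ in (0 : ℝ)..2 * π, (f (circleMap 0 R θ)).re) =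
      (∫ θ in (0 : ℝ)..2 * π, f (circleMap 0 R θ)).re := by
    intro R hR
    have hcont : Continuous fun θ => f (circleMap 0 R θ) :=
      continuous_iff_continuousAt.2 fun θ => (hd _ (circleMap_ne_center hR.ne')).continuousAt.comp
        (continuous_circleMap 0 R).continuousAt
    exact Complex.reCLM.intervalIntegral_comp_comm (hcont.intervalIntegrable _ _)
  rw [hparam 1 one_pos, hparam r hr] at hcirc
  have := mul_left_cancel₀ Complex.I_ne_zero hcirc
  exact (hre 1 one_pos).trans ((congrArg Complex.re this).trans (hre r hr).symm)

lemma integral_cos_mul_sinh_mul_cos {β w : ℝ} (hw : 0 ≤ w) (hwβ : w < β) :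
    (∫ θ in (0 : ℝ)..2 * π,
      Real.cos θ * (Real.sinh (β * Real.cos θ) * Real.cos (w * Real.sin θ))) =
    β * ∫ θ in (0 : ℝ)..2 * π,
      Real.cos θ * Real.sinh (√(β ^ 2 - w ^ 2) * Real.cos θ) / √(β ^ 2 - w ^ 2) := by
  set s := √(β ^ 2 - w ^ 2) with hs
  have hpos : 0 < β ^ 2 - w ^ 2 := by nlinarith
  have hs0 : 0 < s := Real.sqrt_pos.2 hpos
  have hss : s ^ 2 = β ^ 2 - w ^ 2 := Real.sq_sqrt hpos.le
  have hβw : 0 < β + w := by linarith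
  set r := s / (β + w) with hr
  have hr0 : 0 < r := by positivity
  have hr1 : r ≤ 1 := by
    rw [hr, div_le_one hβw]
    nlinarith
  have ha : (β + w) / 2 * r = s / 2 := by rw [hr]; field_simp
  have hb : (β - w) / 2 * r⁻¹ = s / 2 := by
    rw [hr]; field_simp; linear_combination -hss
  have hsum : r + r⁻¹ = 2 * β / s := by
    rw [hr]; field_simp; linear_combination hss
  have h := integral_sinh_laurent_circleMap_eq ((β + w) / 2) ((β - w) / 2) hr0 hr1
  simp only [re_sinh_laurent_circleMap _ _ _ one_ne_zero,
    re_sinh_laurent_circleMap _ _ _ hr0.ne', ha, hb, hsum] at h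
  have e1 : (β + w) / 2 + (β - w) / 2 = β := by ring
  have e2 : (β + w) / 2 - (β - w) / 2 = w := by ring
  simp only [inv_one, mul_one, e1, e2, sub_self, zero_mul, sub_zero, add_halves, Real.cos_zero,
    Real.sin_zero, mul_zero, intervalIntegral.integral_const_mul] at h
  rw [intervalIntegral.integral_div]
  linear_combination h / 2

lemma convexOn_sinh : ConvexOn ℝ (Set.Ici 0) Real.sinh := by
  refine MonotoneOn.convexOn_of_deriv (convex_Ici 0) Real.continuous_sinh.continuousOn
    Real.differentiable_sinh.differentiableOn ?_
  rw [Real.deriv_sinh, interior_Ici]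
  intro x hx y hy hxy
  rw [Real.cosh_le_cosh, abs_of_pos hx, abs_of_pos hy]
  exact hxy

lemma mul_sinh_mul_div_le {s t : ℝ} (hs : 0 < s) (hst : s ≤ t) (c : ℝ) :
    c * Real.sinh (s * c) / s ≤ c * Real.sinh (t * c) / t := by
  have habs : ∀ u : ℝ, c * Real.sinh (u * c) = |c| * Real.sinh (u * |c|) := by
    intro u
    rcases abs_cases c with ⟨h, _⟩ | ⟨h, _⟩ <;> simp [h]
  rw [habs, habs, mul_div_assoc, mul_div_assoc]
  refine mul_le_mul_of_nonneg_left ?_ (abs_nonneg c)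
  have ht : 0 < t := hs.trans_le hst
  have htc : t * |c| ∈ Set.Ici (0 : ℝ) := by
    rw [Set.mem_Ici]
    positivity
  have h := convexOn_sinh.2 htc (Set.mem_Ici.2 le_rfl) (by positivity : 0 ≤ s / t)
    (sub_nonneg.2 ((div_le_one ht).2 hst)) (add_sub_cancel _ _)
  have e : s / t * (t * |c|) = s * |c| := by field_simp
  simp only [smul_eq_mul, mul_zero, add_zero, Real.sinh_zero, e] at h
  rw [div_le_iff₀ hs]
  calc _ ≤ _ := h
    _ = _ := by ring

lemma integral_cos_mul_sinh_div_pos {s : ℝ} (hs : 0 < s) :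
    0 < ∫ θ in (0 : ℝ)..2 * π, Real.cos θ * Real.sinh (s * Real.cos θ) / s := by
  refine intervalIntegral.integral_pos Real.two_pi_pos (by fun_prop) ?_
    ⟨0, ⟨le_rfl, Real.two_pi_pos.le⟩, ?_⟩
  · intro θ _
    refine div_nonneg ?_ hs.le
    rcases le_total 0 (Real.cos θ) with h | h
    · exact mul_nonneg h (Real.sinh_nonneg_iff.2 (mul_nonneg hs.le h))
    · exact mul_nonneg_of_nonpos_of_nonpos h
        (Real.sinh_nonpos_iff.2 (mul_nonpos_of_nonneg_of_nonpos hs.le h))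
  · have : 0 < Real.sinh s := Real.sinh_pos_iff.2 hs
    simp only [Real.cos_zero, mul_one, one_mul]
    positivity

lemma integral_sinh_sqrt_mul_cos (β w : ℝ) :
    (∫ x in (-1 : ℝ)..1, Real.sinh (β * √(1 - x ^ 2)) * Real.cos (w * x)) =
    (1 / 2) * ∫ θ in (0 : ℝ)..2 * π,
      Real.cos θ * (Real.sinh (β * Real.cos θ) * Real.cos (w * Real.sin θ)) := by
  set g : ℝ → ℝ := fun θ =>
    Real.cos θ * (Real.sinh (β * Real.cos θ) * Real.cos (w * Real.sin θ)) with hg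
  have hper : Function.Periodic g π := by
    intro θ
    simp [hg, Real.cos_add_pi, Real.sin_add_pi]
  have hgc : Continuous g := by fun_prop
  have hsub := intervalIntegral.integral_comp_mul_deriv (a := -(π / 2)) (b := π / 2)
    (f := Real.sin) (f' := Real.cos)
    (g := fun x => Real.sinh (β * √(1 - x ^ 2)) * Real.cos (w * x))
    (fun x _ => Real.hasDerivAt_sin x) Real.continuous_cos.continuousOn (by fun_prop)
  rw [Real.sin_neg, Real.sin_pi_div_two] at hsub
  have hhalf : (∫ θ in (-(π / 2))..(π / 2), g θ) = ∫ θ in (0 : ℝ)..π, g θ := by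
    have := hper.intervalIntegral_add_eq (-(π / 2)) 0
    rwa [zero_add, show -(π / 2) + π = π / 2 by ring] at this
  have hfull : (∫ θ in (0 : ℝ)..2 * π, g θ) = 2 * ∫ θ in (0 : ℝ)..π, g θ := by
    have := hper.intervalIntegral_add_eq_add 0 π fun _ _ => hgc.intervalIntegrable _ _
    rw [zero_add] at this
    rw [two_mul π, two_mul, this]
  rw [← hsub, hfull, ← hhalf, ← mul_assoc, one_div, inv_mul_cancel₀ two_ne_zero, one_mul]
  refine intervalIntegral.integral_congr fun θ hθ => ?_
  rw [Set.uIcc_of_le (by linarith [Real.pi_pos])] at hθ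
  have hc : √(1 - Real.sin θ ^ 2) = Real.cos θ := by
    rw [← Real.cos_sq', Real.sqrt_sq (Real.cos_nonneg_of_mem_Icc hθ)]
  simp only [Function.comp, hc, hg]
  ring

lemma omegaSinh_eq (m : ℕ) (σ x : ℝ) :
    omegaSinh m σ x = Real.sinh (2 * π * m * (1 - 1 / (2 * σ)) * √(1 - x ^ 2)) /
      Real.sinh (2 * π * m * (1 - 1 / (2 * σ))) := by
  rw [omegaSinh]
  split_ifs with h
  · rfl
  · have : 1 - x ^ 2 ≤ 0 := by
      rw [not_le, ← one_lt_sq_iff_one_lt_abs] at h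
      linarith
    rw [Real.sqrt_eq_zero_of_nonpos this]
    simp

lemma ftR_omegaSinh (m : ℕ) (σ v : ℝ) :
    ftR (omegaSinh m σ) v =
      (∫ x in (-1 : ℝ)..1, Real.sinh (2 * π * m * (1 - 1 / (2 * σ)) * √(1 - x ^ 2)) *
        Real.cos (2 * π * v * x)) / Real.sinh (2 * π * m * (1 - 1 / (2 * σ))) := by
  rw [ftR, ← setIntegral_eq_integral_of_forall_compl_eq_zero (s := Set.Icc (-1 : ℝ) 1),
    integral_Icc_eq_integral_Ioc, ← intervalIntegral.integral_of_le (by norm_num),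
    ← intervalIntegral.integral_div]
  · refine intervalIntegral.integral_congr fun x _ => ?_
    simp only [omegaSinh_eq]
    ring
  · intro x hx
    rw [omegaSinh, if_neg (fun h => hx (abs_le.1 h)), zero_mul]

lemma ftR_omegaSinh_eq {m : ℕ} {σ v : ℝ} (hv : 0 ≤ v)
    (hvβ : 2 * π * v < 2 * π * m * (1 - 1 / (2 * σ))) :
    ftR (omegaSinh m σ) v =
      2 * π * m * (1 - 1 / (2 * σ)) / (2 * Real.sinh (2 * π * m * (1 - 1 / (2 * σ)))) *
      ∫ θ in (0 : ℝ)..2 * π, Real.cos θ *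
        Real.sinh (√((2 * π * m * (1 - 1 / (2 * σ))) ^ 2 - (2 * π * v) ^ 2) * Real.cos θ) /
          √((2 * π * m * (1 - 1 / (2 * σ))) ^ 2 - (2 * π * v) ^ 2) := by
  rw [ftR_omegaSinh, integral_sinh_sqrt_mul_cos,
    integral_cos_mul_sinh_mul_cos (by positivity) hvβ]
  ring

lemma two_pi_mul_lt_of_mem {m : ℕ} (hm : 2 ≤ m) {σ : ℝ} (hσ : 1 < σ) {v : ℝ}
    (hv : v ≤ m / (2 * σ)) : 2 * π * v < 2 * π * m * (1 - 1 / (2 * σ)) := by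
  have hm0 : (0 : ℝ) < m := by exact_mod_cast (by omega : 0 < m)
  rw [mul_assoc (2 * π)]
  refine mul_lt_mul_of_pos_left (hv.trans_lt ?_) Real.two_pi_pos
  rw [div_eq_mul_one_div]
  refine mul_lt_mul_of_pos_left ?_ hm0
  have : 1 / (2 * σ) < 1 / 2 := one_div_lt_one_div_of_lt two_pos (by linarith)
  linarith

lemma ftR_omegaSinh_pos {m : ℕ} {σ v : ℝ} (hv : 0 ≤ v)
    (hvβ : 2 * π * v < 2 * π * m * (1 - 1 / (2 * σ))) : 0 < ftR (omegaSinh m σ) v := by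
  rw [ftR_omegaSinh_eq hv hvβ]
  have hw : 0 ≤ 2 * π * v := by positivity
  set β := 2 * π * m * (1 - 1 / (2 * σ))
  have hβ : 0 < β := hw.trans_lt hvβ
  have hsinh : 0 < Real.sinh β := Real.sinh_pos_iff.2 hβ
  exact mul_pos (by positivity) (integral_cos_mul_sinh_div_pos (Real.sqrt_pos.2 (by nlinarith)))

lemma ftR_omegaSinh_anti {m : ℕ} {σ v u : ℝ} (hv : 0 ≤ v) (hvu : v ≤ u)
    (huβ : 2 * π * u < 2 * π * m * (1 - 1 / (2 * σ))) :
    ftR (omegaSinh m σ) u ≤ ftR (omegaSinh m σ) v := by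
  have hwv : 0 ≤ 2 * π * v := by positivity
  have hwvu : 2 * π * v ≤ 2 * π * u := mul_le_mul_of_nonneg_left hvu Real.two_pi_pos.le
  rw [ftR_omegaSinh_eq hv (hwvu.trans_lt huβ), ftR_omegaSinh_eq (hv.trans hvu) huβ]
  set β := 2 * π * m * (1 - 1 / (2 * σ))
  have hβ : 0 < β := (hwv.trans hwvu).trans_lt huβ
  have hsinh : 0 < Real.sinh β := Real.sinh_pos_iff.2 hβ
  refine mul_le_mul_of_nonneg_left ?_ (by positivity)
  have hpos : 0 < √(β ^ 2 - (2 * π * u) ^ 2) := Real.sqrt_pos.2 (by nlinarith)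
  have hle : √(β ^ 2 - (2 * π * u) ^ 2) ≤ √(β ^ 2 - (2 * π * v) ^ 2) :=
    Real.sqrt_le_sqrt (by nlinarith)
  exact intervalIntegral.integral_mono Real.two_pi_pos.le
    (Continuous.intervalIntegrable (by fun_prop) _ _)
    (Continuous.intervalIntegrable (by fun_prop) _ _)
    fun θ => mul_sinh_mul_div_le hpos hle (Real.cos θ)

theorem statement13
    (m : ℕ) (hm : 2 ≤ m) (σ : ℝ) (hσ : σ ∈ Set.Icc (5 / 4 : ℝ) 2) :
    (∀ v ∈ Set.Icc (0 : ℝ) ((m : ℝ) / (2 * σ)), 0 < ftR (omegaSinh m σ) v) ∧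
      AntitoneOn (ftR (omegaSinh m σ)) (Set.Icc (0 : ℝ) ((m : ℝ) / (2 * σ))) ∧
      InOmega m σ (omegaSinh m σ) := by
  have hlt : ∀ v ∈ Set.Icc (0 : ℝ) ((m : ℝ) / (2 * σ)),
      2 * π * v < 2 * π * m * (1 - 1 / (2 * σ)) :=
    fun v hv => two_pi_mul_lt_of_mem hm (by linarith [hσ.1]) hv.2
  have hpos : ∀ v ∈ Set.Icc (0 : ℝ) ((m : ℝ) / (2 * σ)), 0 < ftR (omegaSinh m σ) v :=
    fun v hv => ftR_omegaSinh_pos hv.1 (hlt v hv)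
  have hanti : AntitoneOn (ftR (omegaSinh m σ)) (Set.Icc (0 : ℝ) ((m : ℝ) / (2 * σ))) :=
    fun v hv u hu hvu => ftR_omegaSinh_anti hv.1 hvu (hlt u hu)
  have hβ : 0 < 2 * π * m * (1 - 1 / (2 * σ)) := by
    have hσ0 : 0 < σ := by linarith [hσ.1]
    have := hlt 0 ⟨le_rfl, by positivity⟩
    rwa [mul_zero] at this
  have heq : omegaSinh m σ = fun x => Real.sinh (2 * π * m * (1 - 1 / (2 * σ)) * √(1 - x ^ 2)) /
      Real.sinh (2 * π * m * (1 - 1 / (2 * σ))) := funext (omegaSinh_eq m σ)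
  refine ⟨hpos, hanti, ?_, ?_, ?_, fun x hx => by rw [omegaSinh, if_neg hx.not_ge], ?_, ?_, hpos, hanti⟩
  all_goals
    rw [heq]
    clear heq hanti hpos hlt
    set β := 2 * π * m * (1 - 1 / (2 * σ))
    have hsinh : 0 < Real.sinh β := Real.sinh_pos_iff.2 hβ
  · intro x
    refine ⟨div_nonneg (Real.sinh_nonneg_iff.2 (by positivity)) hsinh.le, ?_⟩
    rw [div_le_one hsinh, Real.sinh_le_sinh]
    exact mul_le_of_le_one_right hβ.le (Real.sqrt_le_one.2 (by linarith [sq_nonneg x]))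
  · intro x
    simp only [neg_sq]
  · fun_prop
  · intro x hx y hy hxy
    have hsq : x ^ 2 ≤ y ^ 2 := pow_le_pow_left₀ hx.1 hxy 2
    refine div_le_div_of_nonneg_right (Real.sinh_le_sinh.2 ?_) hsinh.le
    exact mul_le_mul_of_nonneg_left (Real.sqrt_le_sqrt (by linarith)) hβ.le
  · simp [hsinh.ne']
end
end

section
/- Let m1 ∈ ℕ with m1 ≥ 2, β1 := 3m1, and σ1 > π/3. Define the algebraic window function ω_alg(x) := (1 − x²)^{β1 − 1/2} for x ∈ [−1, 1] and ω_alg(x) := 0 otherwise. Then its Fourier transform ω̂_alg(v) := ∫_ℝ ω_alg(x) e^{−2πivx} dx is positive and decreasing for v ∈ [0, m1/(2σ1)]; consequently ω_alg belongs to the set Ω. -/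
open scoped Real
open MeasureTheory Filter Finset

noncomputable section

/-- The algebraic window function `ω_alg(x) = (1 − x²)^{3m₁ − 1/2}` on `[−1,1]`, `0` otherwise. -/
def omegaAlg (m1 : ℕ) (x : ℝ) : ℝ :=
  if |x| ≤ 1 then (1 - x ^ 2) ^ ((3 * m1 : ℝ) - 1 / 2) else 0

/-- The trigonometric form of Poisson's integral for the Bessel function of order `n`, without its
normalising factor. -/
def poissonIntegral (n : ℕ) (z : ℝ) : ℝ :=
  ∫ θ in (-(π / 2))..(π / 2), Real.cos θ ^ (2 * n) * Real.cos (z * Real.sin θ)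

lemma integral_cos_pow_mul_sin_mul_sin (n : ℕ) (z : ℝ) :
    (2 * n + 1) * ∫ θ in (-(π / 2))..(π / 2),
      Real.cos θ ^ (2 * n) * (Real.sin θ * Real.sin (z * Real.sin θ)) =
      z * poissonIntegral (n + 1) z := by
  have hderiv : ∀ θ ∈ Set.uIcc (-(π / 2)) (π / 2),
      HasDerivAt (fun θ ↦ Real.cos θ ^ (2 * n + 1) * Real.sin (z * Real.sin θ))
        (z * (Real.cos θ ^ (2 * (n + 1)) * Real.cos (z * Real.sin θ)) -
          (2 * n + 1) * (Real.cos θ ^ (2 * n) * (Real.sin θ * Real.sin (z * Real.sin θ)))) θ := by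
    intro θ _
    have h := ((Real.hasDerivAt_cos θ).pow (2 * n + 1)).mul
      (((Real.hasDerivAt_sin θ).const_mul z).sin)
    refine h.congr_deriv ?_
    simp only [Nat.add_sub_cancel, Pi.pow_apply]
    push_cast
    ring
  have h := intervalIntegral.integral_eq_sub_of_hasDerivAt hderiv
    (Continuous.intervalIntegrable (by fun_prop) _ _)
  rw [intervalIntegral.integral_sub (Continuous.intervalIntegrable (by fun_prop) _ _)
    (Continuous.intervalIntegrable (by fun_prop) _ _), intervalIntegral.integral_const_mul,
    intervalIntegral.integral_const_mul] at h
  simp only [Real.cos_neg, Real.cos_pi_div_two, ne_eq, Nat.add_eq_zero_iff, one_ne_zero, and_false,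
    not_false_eq_true, zero_pow, zero_mul, sub_zero] at h
  rw [poissonIntegral]
  linarith

lemma poissonIntegral_recurrence (n : ℕ) (z : ℝ) :
    (2 * n + 1) * poissonIntegral n z = 2 * (n + 1) * poissonIntegral (n + 1) z -
      z ^ 2 / (2 * n + 3) * poissonIntegral (n + 2) z := by
  have hderiv : ∀ θ ∈ Set.uIcc (-(π / 2)) (π / 2),
      HasDerivAt (fun θ ↦ Real.cos θ ^ (2 * n + 1) * (Real.sin θ * Real.cos (z * Real.sin θ)))
        (2 * (n + 1) * (Real.cos θ ^ (2 * (n + 1)) * Real.cos (z * Real.sin θ)) -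
          (2 * n + 1) * (Real.cos θ ^ (2 * n) * Real.cos (z * Real.sin θ)) -
          z * (Real.cos θ ^ (2 * (n + 1)) * (Real.sin θ * Real.sin (z * Real.sin θ)))) θ := by
    intro θ _
    have h := ((Real.hasDerivAt_cos θ).pow (2 * n + 1)).mul ((Real.hasDerivAt_sin θ).mul
      (((Real.hasDerivAt_sin θ).const_mul z).cos))
    refine h.congr_deriv ?_
    simp only [Nat.add_sub_cancel, Pi.pow_apply, Pi.mul_apply]
    push_cast
    linear_combination (-(2 * n + 1) * Real.cos θ ^ (2 * n) * Real.cos (z * Real.sin θ)) *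
      Real.sin_sq_add_cos_sq θ
  have h := intervalIntegral.integral_eq_sub_of_hasDerivAt hderiv
    (Continuous.intervalIntegrable (by fun_prop) _ _)
  rw [intervalIntegral.integral_sub (Continuous.intervalIntegrable (by fun_prop) _ _)
    (Continuous.intervalIntegrable (by fun_prop) _ _),
    intervalIntegral.integral_sub (Continuous.intervalIntegrable (by fun_prop) _ _)
    (Continuous.intervalIntegrable (by fun_prop) _ _), intervalIntegral.integral_const_mul,
    intervalIntegral.integral_const_mul, intervalIntegral.integral_const_mul] at h
  simp only [Real.cos_neg, Real.cos_pi_div_two, ne_eq, Nat.add_eq_zero_iff, one_ne_zero, and_false,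
    not_false_eq_true, zero_pow, zero_mul, sub_zero] at h
  have h' := integral_cos_pow_mul_sin_mul_sin (n + 1) z
  push_cast at h'
  have h3 : (2 * n + 3 : ℝ) ≠ 0 := by positivity
  change 2 * (n + 1) * poissonIntegral (n + 1) z - (2 * n + 1) * poissonIntegral n z - _ = 0 at h
  have h'' : ∫ θ in (-(π / 2))..(π / 2),
      Real.cos θ ^ (2 * (n + 1)) * (Real.sin θ * Real.sin (z * Real.sin θ)) =
      z * poissonIntegral (n + 2) z / (2 * n + 3) := by
    rw [eq_div_iff h3]
    linarith
  rw [h''] at h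
  linear_combination -h

lemma hasDerivAt_poissonIntegral (n : ℕ) (z : ℝ) :
    HasDerivAt (poissonIntegral n) (-(z / (2 * n + 1) * poissonIntegral (n + 1) z)) z := by
  have h := (intervalIntegral.hasDerivAt_integral_of_dominated_loc_of_deriv_le
    (μ := volume) (a := -(π / 2)) (b := π / 2) (s := Set.univ) (x₀ := z) (bound := fun _ ↦ 1)
    (F := fun z θ ↦ Real.cos θ ^ (2 * n) * Real.cos (z * Real.sin θ))
    (F' := fun z θ ↦ -(Real.cos θ ^ (2 * n) * (Real.sin θ * Real.sin (z * Real.sin θ))))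
    Filter.univ_mem
    (Filter.Eventually.of_forall fun z ↦ Continuous.aestronglyMeasurable (by fun_prop))
    (Continuous.intervalIntegrable (by fun_prop) _ _)
    (Continuous.aestronglyMeasurable (by fun_prop))
    (Filter.Eventually.of_forall fun θ _ z _ ↦ ?_)
    intervalIntegrable_const
    (Filter.Eventually.of_forall fun θ _ z _ ↦ ?_)).2
  · refine h.congr_deriv ?_
    have h1 : (2 * n + 1 : ℝ) ≠ 0 := by positivity
    rw [intervalIntegral.integral_neg, div_mul_eq_mul_div, ← integral_cos_pow_mul_sin_mul_sin,
      mul_div_cancel_left₀ _ h1]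
  · rw [norm_neg, norm_mul, norm_mul, norm_pow]
    exact mul_le_one₀ (pow_le_one₀ (norm_nonneg _) (Real.abs_cos_le_one θ))
      (by positivity) (mul_le_one₀ (Real.abs_sin_le_one θ) (norm_nonneg _)
        (Real.abs_sin_le_one _))
  · refine (((hasDerivAt_mul_const (Real.sin θ)).cos).const_mul _).congr_deriv ?_
    ring

lemma poissonIntegral_zero_pos (n : ℕ) : 0 < poissonIntegral n 0 := by
  refine intervalIntegral.intervalIntegral_pos_of_pos_on
    (Continuous.intervalIntegrable (by fun_prop) _ _) (fun θ hθ ↦ ?_)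
    (by linarith [Real.pi_pos])
  have := Real.cos_pos_of_mem_Ioo hθ
  simp only [zero_mul, Real.cos_zero, mul_one]
  positivity

lemma poissonIntegral_le_zero (n : ℕ) (z : ℝ) : poissonIntegral n z ≤ poissonIntegral n 0 := by
  refine intervalIntegral.integral_mono_on (by linarith [Real.pi_pos])
    (Continuous.intervalIntegrable (by fun_prop) _ _)
    (Continuous.intervalIntegrable (by fun_prop) _ _) (fun θ _ ↦ ?_)
  rw [zero_mul, Real.cos_zero]
  refine mul_le_mul_of_nonneg_left (Real.cos_le_one _) ?_
  rw [pow_mul]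
  positivity

lemma poissonIntegral_succ_zero (n : ℕ) :
    2 * (n + 1) * poissonIntegral (n + 1) 0 = (2 * n + 1) * poissonIntegral n 0 := by
  simpa using (poissonIntegral_recurrence n 0).symm

lemma le_poissonIntegral (n : ℕ) (z : ℝ) :
    (1 - z ^ 2 / (4 * (n + 1))) * poissonIntegral n 0 ≤ poissonIntegral n z := by
  have h : (1 - z ^ 2 / 2) * poissonIntegral n 0 + z ^ 2 / 2 * poissonIntegral (n + 1) 0 ≤
      poissonIntegral n z := by
    simp only [poissonIntegral]
    rw [← intervalIntegral.integral_const_mul, ← intervalIntegral.integral_const_mul,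
      ← intervalIntegral.integral_add (Continuous.intervalIntegrable (by fun_prop) _ _)
      (Continuous.intervalIntegrable (by fun_prop) _ _)]
    refine intervalIntegral.integral_mono_on (by linarith [Real.pi_pos])
      (Continuous.intervalIntegrable (by fun_prop) _ _)
      (Continuous.intervalIntegrable (by fun_prop) _ _) (fun θ _ ↦ ?_)
    have hc : 0 ≤ Real.cos θ ^ (2 * n) := by rw [pow_mul]; positivity
    calc _ = Real.cos θ ^ (2 * n) * (1 - (z * Real.sin θ) ^ 2 / 2) := by
          rw [zero_mul, Real.cos_zero, mul_pow, Real.sin_sq]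
          ring
      _ ≤ _ := mul_le_mul_of_nonneg_left (Real.one_sub_sq_div_two_le_cos) hc
  have h1 : (n + 1 : ℝ) ≠ 0 := by positivity
  have h2 : poissonIntegral (n + 1) 0 = (2 * n + 1) / (2 * (n + 1)) * poissonIntegral n 0 := by
    rw [div_mul_eq_mul_div, ← poissonIntegral_succ_zero]
    field_simp
  rw [h2] at h
  refine le_of_eq_of_le ?_ h
  field_simp
  ring

/-- Downward induction along the three-term recurrence, started at an order so large that the
quadratic lower bound for the cosine suffices. -/
lemma poissonIntegral_pos {n : ℕ} {z : ℝ} (hz : 0 ≤ z) (hzn : z ≤ n) :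
    0 < poissonIntegral n z := by
  suffices h : 0 < poissonIntegral n z ∧ 0 < poissonIntegral (n + 1) z ∧
      z * poissonIntegral (n + 1) z ≤ (2 * n + 1) * poissonIntegral n z from h.1
  obtain ⟨N, hN⟩ := exists_nat_ge (z ^ 2)
  have large : ∀ k : ℕ, z ^ 2 ≤ k → poissonIntegral k 0 / 2 ≤ poissonIntegral k z := by
    intro k hk
    refine le_trans ?_ (le_poissonIntegral k z)
    have : z ^ 2 / (4 * (k + 1)) ≤ 1 / 2 := by
      rw [div_le_iff₀ (by positivity)]
      linarith
    nlinarith [poissonIntegral_zero_pos k]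
  refine Nat.decreasingInduction' (P := fun k ↦ 0 < poissonIntegral k z ∧
      0 < poissonIntegral (k + 1) z ∧
      z * poissonIntegral (k + 1) z ≤ (2 * k + 1) * poissonIntegral k z)
    (m := n) (n := n + N) ?_ (Nat.le_add_right n N) ?_
  · rintro k - hnk ⟨h1, h2, h3⟩
    push_cast at h3
    have hk : (n : ℝ) ≤ k := by exact_mod_cast hnk
    have h5 : z ^ 2 / (2 * k + 3) * poissonIntegral (k + 2) z ≤ z * poissonIntegral (k + 1) z := by
      rw [div_mul_eq_mul_div, div_le_iff₀ (by positivity)]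
      have := mul_le_mul_of_nonneg_left h3 hz
      linarith
    have hrec := poissonIntegral_recurrence k z
    have h6 : (k + 1) * poissonIntegral (k + 1) z ≤ (2 * k + 1) * poissonIntegral k z := by
      nlinarith
    have h7 : 0 < (2 * k + 1) * poissonIntegral k z :=
      lt_of_lt_of_le (by positivity) h6
    exact ⟨pos_of_mul_pos_right h7 (by positivity), h1, by nlinarith⟩
  · have hl : z ^ 2 ≤ ((n + N : ℕ) : ℝ) := by
      push_cast
      linarith [Nat.cast_nonneg (α := ℝ) n]
    have hzN : z ≤ ((n + N : ℕ) : ℝ) := by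
      push_cast
      linarith [Nat.cast_nonneg (α := ℝ) N]
    have hl' : z ^ 2 ≤ ((n + N + 1 : ℕ) : ℝ) := by
      push_cast at hl ⊢
      linarith
    generalize n + N = k at *
    have a0 := poissonIntegral_zero_pos k
    have a1 := poissonIntegral_zero_pos (k + 1)
    have b0 := large k hl
    have b1 := large (k + 1) hl'
    refine ⟨by linarith, by linarith, ?_⟩
    have c := poissonIntegral_le_zero (k + 1) z
    have d := poissonIntegral_succ_zero k
    have e : poissonIntegral (k + 1) z ≤ 2 * poissonIntegral k z := by nlinarith
    have f : 0 < poissonIntegral k z := by linarith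
    nlinarith

lemma poissonIntegral_antitoneOn (n : ℕ) : AntitoneOn (poissonIntegral n) (Set.Icc 0 (n : ℝ)) := by
  refine antitoneOn_of_deriv_nonpos (convex_Icc _ _)
    (fun z _ ↦ (hasDerivAt_poissonIntegral n z).continuousAt.continuousWithinAt)
    (fun z _ ↦ (hasDerivAt_poissonIntegral n z).differentiableAt.differentiableWithinAt)
    (fun z hz ↦ ?_)
  rw [interior_Icc] at hz
  have := poissonIntegral_pos (n := n + 1) hz.1.le (by push_cast; linarith [hz.2])
  rw [(hasDerivAt_poissonIntegral n z).deriv, neg_nonpos]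
  have := hz.1
  positivity

lemma omegaAlg_eq {m : ℕ} (hm : 1 ≤ m) (x : ℝ) :
    omegaAlg m x = (max (1 - x ^ 2) 0) ^ ((3 * m : ℝ) - 1 / 2) := by
  have hm' : (1 : ℝ) ≤ m := by exact_mod_cast hm
  rw [omegaAlg]
  split_ifs with h
  · rw [max_eq_left (by linarith [(sq_le_one_iff_abs_le_one x).2 h])]
  · rw [max_eq_right, Real.zero_rpow (by linarith)]
    by_contra! hx
    exact h ((sq_le_one_iff_abs_le_one x).1 (by linarith))

lemma continuous_omegaAlg {m : ℕ} (hm : 1 ≤ m) : Continuous (omegaAlg m) := by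
  have hm' : (1 : ℝ) ≤ m := by exact_mod_cast hm
  rw [funext (omegaAlg_eq hm)]
  exact Continuous.rpow_const (by fun_prop) fun x ↦ Or.inr (by linarith)

lemma omegaAlg_sin_mul_cos {m : ℕ} (hm : 1 ≤ m) {θ : ℝ} (hθ : θ ∈ Set.Icc (-(π / 2)) (π / 2)) :
    omegaAlg m (Real.sin θ) * Real.cos θ = Real.cos θ ^ (2 * (3 * m)) := by
  have hm' : (1 : ℝ) ≤ m := by exact_mod_cast hm
  have hc := Real.cos_nonneg_of_mem_Icc hθ
  rw [omegaAlg, if_pos (Real.abs_sin_le_one θ), ← Real.cos_sq', ← Real.rpow_natCast_mul hc]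
  nth_rewrite 2 [← Real.rpow_one (Real.cos θ)]
  rw [← Real.rpow_add_of_nonneg hc (by push_cast; linarith) zero_le_one, ← Real.rpow_natCast]
  congr 1
  push_cast
  ring

lemma ftR_omegaAlg {m : ℕ} (hm : 1 ≤ m) (v : ℝ) :
    ftR (omegaAlg m) v = poissonIntegral (3 * m) (2 * π * v) := by
  have hsupp : Function.support (fun x ↦ omegaAlg m x * Real.cos (2 * π * v * x)) ⊆
      Set.Ioc (-1) 1 := by
    have hm' : (1 : ℝ) ≤ m := by exact_mod_cast hm
    intro x hx
    by_contra hx'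
    apply hx
    have : 1 ≤ x ^ 2 := by
      rw [Set.mem_Ioc, not_and_or, not_lt, not_le] at hx'
      rcases hx' with h | h <;> nlinarith
    simp only [omegaAlg_eq hm]
    rw [max_eq_right (by linarith), Real.zero_rpow (by linarith), zero_mul]
  have hcont := continuous_omegaAlg hm
  have hsub := intervalIntegral.integral_comp_mul_deriv (a := -(π / 2)) (b := π / 2)
    (g := fun x ↦ omegaAlg m x * Real.cos (2 * π * v * x))
    (fun θ _ ↦ Real.hasDerivAt_sin θ) Real.continuous_cos.continuousOn (by fun_prop)
  rw [Real.sin_neg, Real.sin_pi_div_two] at hsub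
  rw [ftR, ← intervalIntegral.integral_eq_integral_of_support_subset hsupp, ← hsub,
    poissonIntegral]
  refine intervalIntegral.integral_congr fun θ hθ ↦ ?_
  rw [Set.uIcc_of_le (by linarith [Real.pi_pos])] at hθ
  simp only [Function.comp_apply]
  rw [← omegaAlg_sin_mul_cos hm hθ]
  ring

theorem statement15
    (m1 : ℕ) (hm1 : 2 ≤ m1) (σ1 : ℝ) (hσ1 : Real.pi / 3 < σ1) :
    (∀ v ∈ Set.Icc (0 : ℝ) ((m1 : ℝ) / (2 * σ1)), 0 < ftR (omegaAlg m1) v) ∧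
      AntitoneOn (ftR (omegaAlg m1)) (Set.Icc (0 : ℝ) ((m1 : ℝ) / (2 * σ1))) ∧
      InOmega m1 σ1 (omegaAlg m1) := by
  have hm : 1 ≤ m1 := by omega
  have hm' : (1 : ℝ) ≤ m1 := by exact_mod_cast hm
  have hexp : (0 : ℝ) ≤ (3 * m1 : ℝ) - 1 / 2 := by linarith
  have hmem : ∀ v ∈ Set.Icc (0 : ℝ) ((m1 : ℝ) / (2 * σ1)),
      2 * π * v ∈ Set.Icc 0 ((3 * m1 : ℕ) : ℝ) := by
    rintro v ⟨hv0, hv⟩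
    have hσ : 0 < σ1 := lt_trans (by positivity) hσ1
    rw [le_div_iff₀ (by positivity)] at hv
    refine ⟨by positivity, ?_⟩
    push_cast
    nlinarith
  have hpos : ∀ v ∈ Set.Icc (0 : ℝ) ((m1 : ℝ) / (2 * σ1)), 0 < ftR (omegaAlg m1) v := by
    intro v hv
    rw [ftR_omegaAlg hm]
    exact poissonIntegral_pos (hmem v hv).1 (hmem v hv).2
  have hanti : AntitoneOn (ftR (omegaAlg m1)) (Set.Icc (0 : ℝ) ((m1 : ℝ) / (2 * σ1))) := by
    intro v hv w hw hvw
    rw [ftR_omegaAlg hm, ftR_omegaAlg hm]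
    exact poissonIntegral_antitoneOn _ (hmem v hv) (hmem w hw)
      (mul_le_mul_of_nonneg_left hvw (by positivity))
  refine ⟨hpos, hanti, fun x ↦ ?_, fun x ↦ ?_, continuous_omegaAlg hm, fun x hx ↦ ?_,
    fun x hx y hy hxy ↦ ?_, ?_, hpos, hanti⟩
  · rw [omegaAlg_eq hm]
    exact ⟨by positivity, Real.rpow_le_one (le_max_right _ _)
      (max_le (by linarith [sq_nonneg x]) zero_le_one) hexp⟩
  · simp [omegaAlg]
  · rw [omegaAlg, if_neg (not_le.2 hx)]
  · rw [omegaAlg_eq hm, omegaAlg_eq hm]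
    refine Real.rpow_le_rpow (le_max_right _ _) (max_le_max_right _ ?_) hexp
    have := pow_le_pow_left₀ hx.1 hxy 2
    linarith
  · simp [omegaAlg]
end
end
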